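/- Let S be a finite subset of ℝ^n. Then the limit cone of the ℤ≥0-span of S is equal to the ℝ≥0-span of S; that is, (ℤ≥0-span S)∞ = ℝ≥0-span S. -/

import Mathlib

/-- The limit cone `S∞` of a subset `S` of a real normed vector space: all vectors
`v = lim εⱼ • μⱼ` for sequences `μⱼ ∈ S` and positive reals `εⱼ → 0`. -/
def limitCone {E : Type*} [NormedAddCommGroup E] [NormedSpace ℝ E] (S : Set E) : Set E :=
  {v | ∃ (μ : ℕ → E) (ε : ℕ → ℝ), (∀ j, μ j ∈ S) ∧ (∀ j, 0 < ε j) ∧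
    Filter.Tendsto ε Filter.atTop (nhds 0) ∧
    Filter.Tendsto (fun j => ε j • μ j) Filter.atTop (nhds v)}

/-- The ℤ≥0-span of a set `S ⊆ ℝ^n`: all finite sums `∑ aᵢ • sᵢ` with `aᵢ ∈ ℕ`, `sᵢ ∈ S`. -/
def zSpanR {n : ℕ} (S : Set (EuclideanSpace ℝ (Fin n))) : Set (EuclideanSpace ℝ (Fin n)) :=
  {x | ∃ (k : ℕ) (a : Fin k → ℕ) (s : Fin k → EuclideanSpace ℝ (Fin n)),
    (∀ i, s i ∈ S) ∧ x = ∑ i, (a i : ℝ) • s i}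

/-- The ℝ≥0-span of a set `S ⊆ ℝ^n`. -/
def rSpanR {n : ℕ} (S : Set (EuclideanSpace ℝ (Fin n))) : Set (EuclideanSpace ℝ (Fin n)) :=
  {x | ∃ (k : ℕ) (a : Fin k → ℝ) (s : Fin k → EuclideanSpace ℝ (Fin n)),
    (∀ i, s i ∈ S) ∧ (∀ i, 0 ≤ a i) ∧ x = ∑ i, a i • s i}

/-- The set of combinations of the elements of a finite set with nonnegative real coefficients. -/
def finsetCone {E : Type*} [AddCommGroup E] [Module ℝ E] (T : Finset E) : Set E :=
  {x | ∃ a : E → ℝ, (∀ v ∈ T, 0 ≤ a v) ∧ x = ∑ v ∈ T, a v • v}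

/-- The reduction step of the conical Carathéodory theorem: a cone over a linearly dependent finite
set is the union of the cones obtained by omitting one generator. -/
lemma finsetCone_eq_iUnion_erase {E : Type*} [AddCommGroup E] [Module ℝ E] [DecidableEq E]
    {T : Finset E} (hT : ¬ LinearIndepOn ℝ id (T : Set E)) :
    finsetCone T = ⋃ v ∈ T, finsetCone (T.erase v) := by
  ext x
  simp only [Set.mem_iUnion]
  constructor
  · rintro ⟨a, ha, rfl⟩
    obtain ⟨g, hg, hpos⟩ : ∃ g : E → ℝ, ∑ v ∈ T, g v • v = 0 ∧ ∃ v ∈ T, 0 < g v := by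
      obtain ⟨g, hg, v, hv, hne⟩ := not_linearIndepOn_finset_iff.1 hT
      simp only [id] at hg
      rcases lt_or_gt_of_ne hne with h | h
      · exact ⟨-g, by simp [hg], v, hv, by simpa using h⟩
      · exact ⟨g, hg, v, hv, h⟩
    obtain ⟨w, hw, hmin⟩ := (T.filter (0 < g ·)).exists_min_image (fun v => a v / g v)
      (by obtain ⟨v, hv, h⟩ := hpos; exact ⟨v, by simp [hv, h]⟩)
    rw [Finset.mem_filter] at hw
    refine ⟨w, hw.1, fun v => a v - a w / g w * g v, fun v hv => ?_, ?_⟩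
    · have hvT := Finset.mem_of_mem_erase hv
      rw [sub_nonneg]
      rcases lt_or_ge 0 (g v) with h | h
      · exact (le_div_iff₀ h).1 (hmin v (by simp [hvT, h]))
      · exact (mul_nonpos_of_nonneg_of_nonpos (div_nonneg (ha w hw.1) hw.2.le) h).trans (ha v hvT)
    · rw [Finset.sum_erase _ (by simp [hw.2.ne'])]
      simp only [sub_smul, mul_smul, Finset.sum_sub_distrib, ← Finset.smul_sum, hg, smul_zero,
        sub_zero]
  · rintro ⟨w, hw, a, ha, rfl⟩
    refine ⟨fun v => if v = w then 0 else a v, fun v hv => ?_, ?_⟩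
    · dsimp only
      split_ifs with h
      · exact le_rfl
      · exact ha v (Finset.mem_erase.2 ⟨h, hv⟩)
    · rw [← Finset.sum_erase T (a := w) (by simp)]
      refine Finset.sum_congr rfl fun v hv => ?_
      simp [(Finset.mem_erase.1 hv).1]

lemma isClosed_finsetCone_of_linearIndepOn {E : Type*} [NormedAddCommGroup E] [NormedSpace ℝ E]
    {T : Finset E} (hT : LinearIndepOn ℝ id (T : Set E)) : IsClosed (finsetCone T) := by
  classical
  have hinj := LinearIndependent.fintypeLinearCombination_injective
    (show LinearIndependent ℝ (fun v : T => (v : E)) from hT)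
  have hemb := LinearMap.isClosedEmbedding_of_injective (LinearMap.ker_eq_bot.2 hinj)
  convert hemb.isClosedMap _ (isClosed_Ici (a := (0 : T → ℝ))) using 1
  ext x
  constructor
  · rintro ⟨a, ha, rfl⟩
    refine ⟨fun v => a v, fun v => ha v v.2, ?_⟩
    rw [Fintype.linearCombination_apply]
    exact Finset.sum_coe_sort T (fun v => a v • v)
  · rintro ⟨a, ha, rfl⟩
    refine ⟨fun v => if h : v ∈ T then a ⟨v, h⟩ else 0, fun v hv => ?_, ?_⟩
    · simpa [hv] using ha ⟨v, hv⟩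
    · rw [Fintype.linearCombination_apply, ← Finset.sum_coe_sort T]
      simp

lemma isClosed_finsetCone {E : Type*} [NormedAddCommGroup E] [NormedSpace ℝ E] (T : Finset E) :
    IsClosed (finsetCone T) := by
  classical
  induction T using Finset.strongInduction with
  | H T ih =>
    by_cases hT : LinearIndepOn ℝ id (T : Set E)
    · exact isClosed_finsetCone_of_linearIndepOn hT
    · rw [finsetCone_eq_iUnion_erase hT]
      exact T.finite_toSet.isClosed_biUnion fun v hv => ih _ (Finset.erase_ssubset hv)

lemma rSpanR_coe_finset {n : ℕ} (T : Finset (EuclideanSpace ℝ (Fin n))) :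
    rSpanR (T : Set (EuclideanSpace ℝ (Fin n))) = finsetCone T := by
  classical
  ext x
  constructor
  · rintro ⟨k, a, s, hs, ha, rfl⟩
    refine ⟨fun v => ∑ i with s i = v, a i, fun v _ => Finset.sum_nonneg fun i _ => ha i, ?_⟩
    rw [← Finset.sum_fiberwise_of_maps_to (t := T) (g := s) (fun i _ => hs i)]
    refine Finset.sum_congr rfl fun v _ => ?_
    rw [Finset.sum_smul]
    refine Finset.sum_congr rfl fun i hi => ?_
    rw [(Finset.mem_filter.1 hi).2]
  · rintro ⟨a, ha, rfl⟩
    refine ⟨T.card, fun i => a (T.equivFin.symm i), fun i => T.equivFin.symm i,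
      fun i => (T.equivFin.symm i).2, fun i => ha _ (T.equivFin.symm i).2, ?_⟩
    rw [← Finset.sum_coe_sort T]
    exact (Equiv.sum_comp T.equivFin.symm (fun v : T => a v • (v : EuclideanSpace ℝ (Fin n)))).symm

lemma rSpanR_subset_limitCone_zSpanR {n : ℕ} (S : Set (EuclideanSpace ℝ (Fin n))) :
    rSpanR S ⊆ limitCone (zSpanR S) := by
  rintro _ ⟨k, a, s, hs, ha, rfl⟩
  refine ⟨fun j => ∑ i, (⌊a i * ((j : ℝ) + 1)⌋₊ : ℝ) • s i, fun j => 1 / ((j : ℝ) + 1),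
    fun j => ⟨k, _, s, hs, rfl⟩, fun j => by positivity,
    tendsto_one_div_add_atTop_nhds_zero_nat, ?_⟩
  simp only [Finset.smul_sum, smul_smul, one_div_mul_eq_div]
  have htop : Filter.Tendsto (fun j : ℕ => (j : ℝ) + 1) Filter.atTop Filter.atTop :=
    Filter.tendsto_atTop_add_const_right _ _ tendsto_natCast_atTop_atTop
  exact tendsto_finsetSum _ fun i _ =>
    ((tendsto_nat_floor_mul_div_atTop (ha i)).comp htop).smul_const (s i)

/-- For a finite subset `S ⊆ ℝ^n`, the limit cone of the ℤ≥0-span of `S`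
equals the ℝ≥0-span of `S`. -/
theorem stmt5 (n : ℕ) (S : Set (EuclideanSpace ℝ (Fin n))) (hS : S.Finite) :
    limitCone (zSpanR S) = rSpanR S := by
  refine Set.Subset.antisymm ?_ (rSpanR_subset_limitCone_zSpanR S)
  rintro v ⟨μ, ε, hμ, hε, -, hv⟩
  have hclosed : IsClosed (rSpanR S) := by
    rw [← hS.coe_toFinset, rSpanR_coe_finset]
    exact isClosed_finsetCone _
  refine hclosed.mem_of_tendsto hv (Filter.Eventually.of_forall fun j => ?_)
  obtain ⟨k, a, s, hs, h⟩ := hμ j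
  refine ⟨k, fun i => ε j * a i, s, hs, fun i => mul_nonneg (hε j).le (Nat.cast_nonneg _), ?_⟩
  simp only [h, Finset.smul_sum, mul_smul]
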